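/- Let L be of Lévy type, i.e., for f ∈ 𝒟_w, Lf(μ) = −κ_μ f(μ) + ⟨B_μ(∂f(μ)), μ⟩ + (1/2)⟨Q_μ(∂²f(μ)), μ²⟩ + ∫_{𝒫_w} ( f(ν) − f(μ) − ⟨∂f(μ), χ(ν−μ)⟩ ) N(μ,dν), and suppose L satisfies conditions (i)–(ii): L satisfies the positive maximum principle on 𝒫_w and Lf ∈ C(𝒫_w) for f ∈ 𝒟_w. Assume that for every φ ∈ C_w^∞ the following functions of μ ∈ 𝒫_w are of C₀ type: (a) μ ↦ κ_μ e^{-⟨w,μ⟩}; (b) μ ↦ ⟨B_μ(φ),μ⟩ e^{-⟨w,μ⟩}; (c) μ ↦ ⟨Q_μ(φ⊗φ),μ²⟩ e^{-⟨w,μ⟩}; (d) μ ↦ e^{-⟨w,μ⟩} ∫_{𝒫_w} ( ⟨φ,ν⟩ e^{-⟨w,ν−μ⟩} − ⟨φ,μ⟩ − ⟨φ − w⟨φ,μ⟩, χ(ν−μ)⟩ ) N(μ,dν); and (e) for every integer k ≥ 2, μ ↦ e^{-k⟨w,μ⟩} ∫_{𝒫_w} ( ⟨φ,ν⟩ e^{-⟨w,ν−μ⟩}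 − ⟨φ,μ⟩ )^k N(μ,dν). Then Lf is of C₀ type for every f ∈ 𝒟_w. -/

import Mathlib

open MeasureTheory Filter Topology
open scoped NNReal ENNReal ZeroAtInfty

noncomputable section

instance (X : Type*) [TopologicalSpace X] : MeasurableSpace (OnePoint X) := borel _
instance (X : Type*) [TopologicalSpace X] : BorelSpace (OnePoint X) := ⟨rfl⟩

/-- The derivative `∂_x f(μ) = lim_{ε→0} (f(μ + ε δ_x) − f(μ))/ε` of a function of a
(nonnegative) measure argument, realized as the derivative at `0` from within `[0,∞)`
(which coincides with the two-sided derivative for the smooth functionals considered). -/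
def mderiv {X : Type*} [MeasurableSpace X]
    (f : Measure X → ℝ) (μ : Measure X) (x : X) : ℝ :=
  derivWithin (fun ε : ℝ => f (μ + ENNReal.ofReal ε • Measure.dirac x)) (Set.Ici 0) 0

/-- The second derivative `∂²_{x,y} f(μ) = ∂_x(∂_y f)(μ)`. -/
def mderiv2 {X : Type*} [MeasurableSpace X]
    (f : Measure X → ℝ) (μ : Measure X) (x y : X) : ℝ :=
  mderiv (fun ν => mderiv f ν y) μ x

/-- The generators `μ ↦ ⟨φ,μ⟩ e^{-⟨w,μ⟩}`, `φ ∈ C_c^∞(ℝ^d)`, of the algebra `𝒟_w`. -/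
def DwGen {d : ℕ} (w : EuclideanSpace ℝ (Fin d) → ℝ) :
    Set (Measure (EuclideanSpace ℝ (Fin d)) → ℝ) :=
  {g | ∃ φ : EuclideanSpace ℝ (Fin d) → ℝ, ContDiff ℝ (⊤ : ℕ∞) φ ∧ HasCompactSupport φ ∧
    g = fun μ => (∫ x, φ x ∂μ) * Real.exp (-(∫ x, w x ∂μ))}

/-- The space `C_w^∞`: the linear span of `w` and `C_c^∞(ℝ^d)`. -/
def CwInf {d : ℕ} (w : EuclideanSpace ℝ (Fin d) → ℝ) :
    Set (EuclideanSpace ℝ (Fin d) → ℝ) :=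
  {φ | ∃ (c : ℝ) (ψ : EuclideanSpace ℝ (Fin d) → ℝ),
    ContDiff ℝ (⊤ : ℕ∞) ψ ∧ HasCompactSupport ψ ∧ φ = fun x => c * w x + ψ x}

/-- The tensor space `C_w^∞ ⊗ C_w^∞`: finite sums of products `φ₁(x)φ₂(y)`. -/
def CwTensor {d : ℕ} (w : EuclideanSpace ℝ (Fin d) → ℝ) :
    Set (EuclideanSpace ℝ (Fin d) × EuclideanSpace ℝ (Fin d) → ℝ) :=
  Submodule.span ℝ {g | ∃ φ₁ ∈ CwInf w, ∃ φ₂ ∈ CwInf w,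
    g = fun p : EuclideanSpace ℝ (Fin d) × EuclideanSpace ℝ (Fin d) => φ₁ p.1 * φ₂ p.2}

/-- `w⁻¹` extended to `E^Δ` by `w⁻¹(Δ) = 0`. -/
def winvOP {d : ℕ} (w : EuclideanSpace ℝ (Fin d) → ℝ) (E : Set (EuclideanSpace ℝ (Fin d))) :
    OnePoint E → ℝ :=
  fun z => z.elim 0 (fun y => (w y.1)⁻¹)

/-- The state space `𝒳 = {ν ∈ M_+(E^Δ) : ⟨w⁻¹,ν⟩ = 1}`, as a subtype of the space of finite
measures on `E^Δ` with the topology of weak convergence. -/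
def XSp {d : ℕ} (w : EuclideanSpace ℝ (Fin d) → ℝ) (E : Set (EuclideanSpace ℝ (Fin d))) :
    Type :=
  {ν : FiniteMeasure (OnePoint E) //
    (∫⁻ x, ENNReal.ofReal (winvOP w E x) ∂ν.toMeasure) = 1}

instance {d : ℕ} (w : EuclideanSpace ℝ (Fin d) → ℝ) (E : Set (EuclideanSpace ℝ (Fin d))) :
    TopologicalSpace (XSp w E) :=
  instTopologicalSpaceSubtype

/-- The inclusion `ℝ^d ⊇ E → E^Δ` (sending points outside `E` to `Δ`). -/
def toOP {d : ℕ} (E : Set (EuclideanSpace ℝ (Fin d))) (x : EuclideanSpace ℝ (Fin d)) :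
    OnePoint E :=
  @dite _ (x ∈ E) (Classical.dec _) (fun h => OnePoint.some ⟨x, h⟩) (fun _ => OnePoint.infty)

/-- A function `g : 𝒫_w → ℝ` is of `C₀` type if `g ∘ T⁻¹ : T(𝒫_w) → ℝ` extends to a
continuous function on `𝒳` vanishing at infinity, where `T(μ)(A) = ∫_{A∩E} w dμ`. -/
def IsC0Type {d : ℕ} (w : EuclideanSpace ℝ (Fin d) → ℝ) (E : Set (EuclideanSpace ℝ (Fin d)))
    (g : Measure (EuclideanSpace ℝ (Fin d)) → ℝ) : Prop :=
  ∃ F : C₀(XSp w E, ℝ),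
    ∀ μ : Measure (EuclideanSpace ℝ (Fin d)),
      IsProbabilityMeasure μ → Integrable w μ → μ Eᶜ = 0 →
      ∀ ν : XSp w E,
        ν.1.toMeasure = (μ.withDensity (fun x => ENNReal.ofReal (w x))).map (toOP E) →
        F ν = g μ

/-- coefficients -/
theorem coeff_mem {V : Type*} [AddCommGroup V] [Module ℝ V] (W : Submodule ℝ V) (n : ℕ)
    (c : Fin n → V) (h : ∀ t : ℝ, ∑ i : Fin n, t ^ (i : ℕ) • c i ∈ W) (i : Fin n) : c i ∈ W := by
  let v : Fin n → ℝ := fun j => (j : ℕ)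
  have hv : Function.Injective v := fun a b hab => by
    have : ((a : ℕ) : ℝ) = (b : ℕ) := hab
    exact Fin.ext (by exact_mod_cast this)
  have hdet : IsUnit (Matrix.vandermonde v).det :=
    isUnit_iff_ne_zero.mpr (Matrix.det_vandermonde_ne_zero_iff.mpr hv)
  have hM := Matrix.nonsing_inv_mul _ hdet
  have key : c i = ∑ j, (Matrix.vandermonde v)⁻¹ i j • ∑ k : Fin n, (v j) ^ (k : ℕ) • c k := by
    simp only [Finset.smul_sum, smul_smul]
    rw [Finset.sum_comm]
    simp only [← Finset.sum_smul]
    have : ∀ k : Fin n, ∑ j, (Matrix.vandermonde v)⁻¹ i j * v j ^ (k : ℕ) = if i = k then 1 else 0 := by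
      intro k
      have := congrFun (congrFun hM i) k
      rw [Matrix.mul_apply, Matrix.one_apply] at this
      simpa [Matrix.vandermonde_apply] using this
    simp [this]
  rw [key]
  exact W.sum_mem fun j _ => W.smul_mem _ (h _)

lemma adjoin_le_span {A : Type*} [CommRing A] [Algebra ℝ A] (S : Set A)
    (hS : ∀ t : ℝ, ∀ g ∈ S, ∀ h ∈ S, h + t • g ∈ S) (f : A)
    (hf : f ∈ NonUnitalAlgebra.adjoin ℝ S) :
    f ∈ Submodule.span ℝ {p | ∃ g ∈ S, ∃ m : ℕ, p = g ^ (m + 1)} := by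
  set W := Submodule.span ℝ {p | ∃ g ∈ S, ∃ m : ℕ, p = g ^ (m + 1)} with hW
  have hmul : ∀ g ∈ S, ∀ h ∈ S, ∀ k l : ℕ, g ^ (k+1) * h ^ (l+1) ∈ W := by
    intro g hg h hh k l
    let n := k + l + 1
    have := coeff_mem W (n + 2) (fun i => ((n+1).choose i : ℝ) • (g ^ (i : ℕ) * h ^ (n + 1 - (i : ℕ))))
      (fun t => by
        have e : ∑ i : Fin (n+2), t ^ (i : ℕ) • (((n+1).choose i : ℝ) • (g ^ (i : ℕ) * h ^ (n + 1 - (i : ℕ))) : A)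
          = (h + t • g) ^ (n+1) := by
          rw [add_comm h, add_pow, Finset.sum_range]
          refine Finset.sum_congr rfl fun i _ => ?_
          rw [smul_pow]
          simp only [Algebra.smul_def, map_natCast]
          ring
        rw [e]
        exact Submodule.subset_span ⟨_, hS t g hg h hh, n, rfl⟩) ⟨k+1, by omega⟩
    have hne : ((n+1).choose (k+1) : ℝ) ≠ 0 := by
      exact_mod_cast (Nat.choose_pos (by omega)).ne'
    have h2 := W.smul_mem ((n+1).choose (k+1) : ℝ)⁻¹ this
    simp only [smul_smul, inv_mul_cancel₀ hne, one_smul] at h2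
    have e2 : n + 1 - (k+1) = l + 1 := by omega
    rwa [e2] at h2
  induction hf using NonUnitalAlgebra.adjoin_induction with
  | mem x hx => exact Submodule.subset_span ⟨x, hx, 0, by simp⟩
  | add x y _ _ hx hy => exact W.add_mem hx hy
  | zero => exact W.zero_mem
  | smul r x _ hx => exact W.smul_mem r hx
  | mul x y _ _ hx hy =>
    refine Submodule.span_induction₂ (p := fun a b _ _ => a * b ∈ W) ?_ ?_ ?_ ?_ ?_ ?_ ?_ hx hy
    · rintro _ _ ⟨g, hg, k, rfl⟩ ⟨h, hh, l, rfl⟩; exact hmul g hg h hh k l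
    · intros; simp
    · intros; simp
    · intro a b c _ _ _ h1 h2; rw [add_mul]; exact W.add_mem h1 h2
    · intro a b c _ _ _ h1 h2; rw [mul_add]; exact W.add_mem h1 h2
    · intro r a b _ _ h1; rw [smul_mul_assoc]; exact W.smul_mem _ h1
    · intro r a b _ _ h1; rw [mul_smul_comm]; exact W.smul_mem _ h1

section helpers
variable {d : ℕ} {w : EuclideanSpace ℝ (Fin d) → ℝ} {E : Set (EuclideanSpace ℝ (Fin d))}

/-- Membership in the state space. -/
def PwS (w : EuclideanSpace ℝ (Fin d) → ℝ) (E : Set (EuclideanSpace ℝ (Fin d))) :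
    Set (Measure (EuclideanSpace ℝ (Fin d))) :=
  {μ | IsProbabilityMeasure μ ∧ Integrable w μ ∧ μ Eᶜ = 0}

lemma c0_congr {g g' : Measure (EuclideanSpace ℝ (Fin d)) → ℝ} (h : IsC0Type w E g)
    (hh : ∀ μ ∈ PwS w E, g' μ = g μ) : IsC0Type w E g' := by
  obtain ⟨F, hF⟩ := h
  exact ⟨F, fun μ h1 h2 h3 ν hν => by rw [hF μ h1 h2 h3 ν hν, hh μ ⟨h1, h2, h3⟩]⟩

lemma c0_add {g g' : Measure (EuclideanSpace ℝ (Fin d)) → ℝ} (h : IsC0Type w E g)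
    (h' : IsC0Type w E g') : IsC0Type w E (fun μ => g μ + g' μ) := by
  obtain ⟨F, hF⟩ := h
  obtain ⟨F', hF'⟩ := h'
  exact ⟨F + F', fun μ h1 h2 h3 ν hν => by
    simp [hF μ h1 h2 h3 ν hν, hF' μ h1 h2 h3 ν hν]⟩

/-- Bounded continuous type. -/
def IsCbType (w : EuclideanSpace ℝ (Fin d) → ℝ) (E : Set (EuclideanSpace ℝ (Fin d)))
    (g : Measure (EuclideanSpace ℝ (Fin d)) → ℝ) : Prop :=
  ∃ H : XSp w E → ℝ, Continuous H ∧ (∃ C, ∀ ν, |H ν| ≤ C) ∧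
    ∀ μ : Measure (EuclideanSpace ℝ (Fin d)),
      IsProbabilityMeasure μ → Integrable w μ → μ Eᶜ = 0 →
      ∀ ν : XSp w E,
        ν.1.toMeasure = (μ.withDensity (fun x => ENNReal.ofReal (w x))).map (toOP E) →
        H ν = g μ

lemma cb_const (c : ℝ) : IsCbType w E (fun _ => c) :=
  ⟨fun _ => c, continuous_const, ⟨|c|, fun _ => le_rfl⟩, fun _ _ _ _ _ _ => rfl⟩

lemma cb_mul {g g' : Measure (EuclideanSpace ℝ (Fin d)) → ℝ} (h : IsCbType w E g)
    (h' : IsCbType w E g') : IsCbType w E (fun μ => g μ * g' μ) := by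
  obtain ⟨F, hc, ⟨C, hC⟩, hF⟩ := h
  obtain ⟨F', hc', ⟨C', hC'⟩, hF'⟩ := h'
  refine ⟨fun ν => F ν * F' ν, hc.mul hc', ⟨C * C', fun ν => ?_⟩, fun μ h1 h2 h3 ν hν => ?_⟩
  · rw [abs_mul]
    exact mul_le_mul (hC ν) (hC' ν) (abs_nonneg _) ((abs_nonneg _).trans (hC ν))
  · simp [hF μ h1 h2 h3 ν hν, hF' μ h1 h2 h3 ν hν]

lemma cb_pow {g : Measure (EuclideanSpace ℝ (Fin d)) → ℝ} (h : IsCbType w E g) (n : ℕ) :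
    IsCbType w E (fun μ => g μ ^ n) := by
  induction n with
  | zero => simpa using cb_const (w := w) (E := E) 1
  | succ n ih => simpa [pow_succ] using cb_mul ih h

lemma c0_mul {g g' : Measure (EuclideanSpace ℝ (Fin d)) → ℝ} (h : IsCbType w E g)
    (h' : IsC0Type w E g') : IsC0Type w E (fun μ => g μ * g' μ) := by
  obtain ⟨F, hc, ⟨C, hC⟩, hF⟩ := h
  obtain ⟨F', hF'⟩ := h'
  have hz : Tendsto (fun ν => F ν * F' ν) (cocompact (XSp w E)) (𝓝 0) := by
    have h0 := F'.zero_at_infty'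
    have h1 : Tendsto (fun ν => C * |F' ν|) (cocompact (XSp w E)) (𝓝 0) := by
      simpa using h0.abs.const_mul C
    refine squeeze_zero_norm (fun ν => ?_) h1
    rw [Real.norm_eq_abs, abs_mul]
    exact mul_le_mul_of_nonneg_right (hC ν) (abs_nonneg _)
  refine ⟨⟨⟨fun ν => F ν * F' ν, hc.mul F'.continuous⟩, hz⟩, fun μ h1 h2 h3 ν hν => ?_⟩
  show F ν * F' ν = _
  simp [hF μ h1 h2 h3 ν hν, hF' μ h1 h2 h3 ν hν]

lemma c0_const_mul {g : Measure (EuclideanSpace ℝ (Fin d)) → ℝ} (c : ℝ)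
    (h : IsC0Type w E g) : IsC0Type w E (fun μ => c * g μ) :=
  c0_mul (cb_const c) h

lemma c0_sum {g : ℕ → Measure (EuclideanSpace ℝ (Fin d)) → ℝ} (s : Finset ℕ)
    (h : ∀ i ∈ s, IsC0Type w E (g i)) : IsC0Type w E (fun μ => ∑ i ∈ s, g i μ) := by
  classical
  induction s using Finset.induction_on with
  | empty => exact ⟨0, by simp⟩
  | insert a s ha ih =>
    simp only [Finset.sum_insert ha]
    exact c0_add (h a (by simp)) (ih fun i hi => h i (by simp [hi]))

lemma measurable_toOP (hE : IsClosed E) : Measurable (toOP E) := by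
  classical
  intro s hs
  have h1 : MeasurableSet ((OnePoint.some : E → OnePoint E) ⁻¹' s) :=
    (OnePoint.continuous_coe.measurable) hs
  have h2 : MeasurableSet (Subtype.val '' ((OnePoint.some : E → OnePoint E) ⁻¹' s)) :=
    hE.measurableSet.subtype_image h1
  by_cases hi : OnePoint.infty ∈ s
  · convert h2.union hE.measurableSet.compl using 1
    ext x
    by_cases hx : x ∈ E <;> simp [toOP, hx, hi]
  · convert h2 using 1
    ext x
    by_cases hx : x ∈ E <;> simp [toOP, hx, hi]

/-- Extension of φ/w to the one-point compactification. -/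
def extOP (w φ : EuclideanSpace ℝ (Fin d) → ℝ) (E : Set (EuclideanSpace ℝ (Fin d))) :
    OnePoint E → ℝ :=
  fun z => z.elim 0 (fun y => φ y.1 / w y.1)

lemma continuous_extOP (hE : IsClosed E) (hw : Continuous w) (hw1 : ∀ x, 1 ≤ w x)
    {φ : EuclideanSpace ℝ (Fin d) → ℝ} (hφ : Continuous φ) (hc : HasCompactSupport φ) :
    Continuous (extOP w φ E) := by
  rw [OnePoint.continuous_iff]
  constructor
  · show Tendsto (fun y : E => φ y.1 / w y.1) _ (𝓝 0)
    have hK : IsCompact ((Subtype.val : E → _) ⁻¹' tsupport φ) :=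
      hE.isClosedEmbedding_subtypeVal.isCompact_preimage hc
    refine tendsto_const_nhds.congr' ?_
    have hm : ((Subtype.val : E → _) ⁻¹' tsupport φ)ᶜ ∈ coclosedCompact E := by
      rw [mem_coclosedCompact_iff]
      rw [compl_compl, ((isClosed_tsupport φ).preimage continuous_subtype_val).closure_eq]
      exact hK
    filter_upwards [hm] with y hy
    have : φ y.1 = 0 := image_eq_zero_of_notMem_tsupport hy
    simp [this]
  · show Continuous (fun y : E => φ y.1 / w y.1)
    exact (hφ.comp continuous_subtype_val).div (hw.comp continuous_subtype_val)
      (fun y => by have := hw1 y.1; positivity)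

lemma ext_bound {φ : EuclideanSpace ℝ (Fin d) → ℝ} (hw1 : ∀ x, 1 ≤ w x) {C : ℝ}
    (hC : ∀ x, |φ x| ≤ C) (z : OnePoint E) : |extOP w φ E z| ≤ C * winvOP w E z := by
  induction z using OnePoint.rec with
  | infty => simp [extOP, winvOP]
  | coe y =>
    simp only [extOP, winvOP, OnePoint.elim_some]
    have h0 : 0 < w y.1 := lt_of_lt_of_le one_pos (hw1 _)
    rw [abs_div, abs_of_pos h0, div_eq_mul_inv]
    exact mul_le_mul_of_nonneg_right (hC _) (by positivity)

lemma cb_phi (hE : IsClosed E) (hw : Continuous w) (hw1 : ∀ x, 1 ≤ w x)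
    {φ : EuclideanSpace ℝ (Fin d) → ℝ} (hφ : Continuous φ) (hc : HasCompactSupport φ) :
    IsCbType w E (fun μ => ∫ x, φ x ∂μ) := by
  obtain ⟨C, hC⟩ := hc.exists_bound_of_continuous hφ
  have hC0 : 0 ≤ C := (norm_nonneg _).trans (hC 0)
  have hcont := continuous_extOP hE hw hw1 hφ hc
  let b : BoundedContinuousFunction (OnePoint E) ℝ :=
    BoundedContinuousFunction.mkOfCompact ⟨extOP w φ E, hcont⟩
  refine ⟨fun ν => ∫ z, extOP w φ E z ∂ν.1.toMeasure, ?_, ⟨C, fun ν => ?_⟩, ?_⟩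
  · exact (FiniteMeasure.continuous_integral_boundedContinuousFunction b).comp
      continuous_subtype_val
  · have h1 := norm_integral_le_lintegral_norm (μ := ν.1.toMeasure) (extOP w φ E)
    rw [← Real.norm_eq_abs]
    refine h1.trans ?_
    have h2 : (∫⁻ z, ENNReal.ofReal ‖extOP w φ E z‖ ∂ν.1.toMeasure) ≤ ENNReal.ofReal C := by
      calc _ ≤ ∫⁻ z, ENNReal.ofReal C * ENNReal.ofReal (winvOP w E z) ∂ν.1.toMeasure := by
            refine lintegral_mono fun z => ?_
            rw [← ENNReal.ofReal_mul hC0]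
            exact ENNReal.ofReal_le_ofReal (ext_bound hw1 hC z)
        _ = ENNReal.ofReal C := by
            rw [lintegral_const_mul' _ _ ENNReal.ofReal_ne_top, ν.2, mul_one]
    exact ENNReal.toReal_le_of_le_ofReal hC0 h2
  · intro μ h1 h2 h3 ν hν
    simp only [hν]
    rw [integral_map (measurable_toOP hE).aemeasurable hcont.aestronglyMeasurable]
    have hm : Measurable (fun x => Real.toNNReal (w x)) := hw.measurable.real_toNNReal
    have := integral_withDensity_eq_integral_smul (μ := μ) hm (fun x => extOP w φ E (toOP E x))
    refine this.trans (integral_congr_ae ?_)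
    have hae : ∀ᵐ x ∂μ, x ∈ E := by
      rw [ae_iff]; exact h3
    filter_upwards [hae] with x hx
    have h0 : 0 < w x := lt_of_lt_of_le one_pos (hw1 _)
    simp only [toOP, hx, extOP, dite_true, OnePoint.elim_some, NNReal.smul_def, smul_eq_mul,
      Real.coe_toNNReal _ h0.le]
    field_simp

lemma cb_exp (hE : IsClosed E) (hw1 : ∀ x, 1 ≤ w x) :
    IsCbType w E (fun μ => Real.exp (-(∫ x, w x ∂μ))) := by
  refine ⟨fun ν => Real.exp (-(ν.1.mass : ℝ)), ?_, ⟨1, fun ν => ?_⟩, ?_⟩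
  · have : Continuous (fun ν : XSp w E => ν.1.mass) :=
      FiniteMeasure.continuous_mass.comp continuous_subtype_val
    fun_prop
  · rw [abs_of_pos (Real.exp_pos _), Real.exp_le_one_iff]
    simp
  · intro μ h1 h2 h3 ν hν
    have : (ν.1.mass : ℝ) = ∫ x, w x ∂μ := by
      have h4 : (ν.1.mass : ℝ) = (ν.1.toMeasure Set.univ).toReal := rfl
      rw [h4, hν, Measure.map_apply (measurable_toOP hE) MeasurableSet.univ, Set.preimage_univ,
        withDensity_apply _ MeasurableSet.univ, Measure.restrict_univ,
        integral_eq_lintegral_of_nonneg_ae (.of_forall fun x => zero_le_one.trans (hw1 x))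
          h2.aestronglyMeasurable]
    simp [this]

/-- Finite measures integrating w. -/
def MW (w : EuclideanSpace ℝ (Fin d) → ℝ) (μ : Measure (EuclideanSpace ℝ (Fin d))) : Prop :=
  IsFiniteMeasure μ ∧ Integrable w μ

lemma PwS.mw {μ : Measure (EuclideanSpace ℝ (Fin d))} (h : μ ∈ PwS w E) : MW w μ := by
  obtain ⟨h1, h2, h3⟩ := h
  exact ⟨inferInstance, h2⟩

lemma MW.integrable {μ : Measure (EuclideanSpace ℝ (Fin d))} (h : MW w μ)
    {φ : EuclideanSpace ℝ (Fin d) → ℝ} (hφ : φ ∈ CwInf w) : Integrable φ μ := by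
  obtain ⟨h1, h2⟩ := h
  obtain ⟨c, ψ, h3, h4, rfl⟩ := hφ
  exact (h2.const_mul c).add (h3.continuous.integrable_of_hasCompactSupport h4)

lemma integrable_smul_dirac (φ : EuclideanSpace ℝ (Fin d) → ℝ)
    (ε : ℝ) (x : EuclideanSpace ℝ (Fin d)) :
    Integrable φ (ENNReal.ofReal ε • Measure.dirac x) :=
  (integrable_dirac (by simp)).smul_measure ENNReal.ofReal_ne_top

lemma MW.add_dirac {μ : Measure (EuclideanSpace ℝ (Fin d))} (h : MW w μ)
    (ε : ℝ) (x : EuclideanSpace ℝ (Fin d)) :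
    MW w (μ + ENNReal.ofReal ε • Measure.dirac x) := by
  obtain ⟨h1, h2⟩ := h
  have : IsFiniteMeasure (ENNReal.ofReal ε • Measure.dirac x) :=
    Measure.smul_finite _ ENNReal.ofReal_ne_top
  exact ⟨inferInstance, h2.add_measure (integrable_smul_dirac w ε x)⟩

lemma integral_pert {φ : EuclideanSpace ℝ (Fin d) → ℝ}
    {μ : Measure (EuclideanSpace ℝ (Fin d))} (h : Integrable φ μ)
    {ε : ℝ} (hε : 0 ≤ ε) (x : EuclideanSpace ℝ (Fin d)) :
    ∫ y, φ y ∂(μ + ENNReal.ofReal ε • Measure.dirac x) = (∫ y, φ y ∂μ) + ε * φ x := by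
  rw [integral_add_measure h (integrable_smul_dirac φ ε x), integral_smul_measure,
    integral_dirac, ENNReal.toReal_ofReal hε, smul_eq_mul]

/-- The generator. -/
def gen (w φ : EuclideanSpace ℝ (Fin d) → ℝ) (μ : Measure (EuclideanSpace ℝ (Fin d))) : ℝ :=
  (∫ x, φ x ∂μ) * Real.exp (-(∫ x, w x ∂μ))

lemma hasDeriv_phi {φ : EuclideanSpace ℝ (Fin d) → ℝ}
    {μ : Measure (EuclideanSpace ℝ (Fin d))} (h : Integrable φ μ)
    (x : EuclideanSpace ℝ (Fin d)) :
    HasDerivWithinAt (fun ε : ℝ => ∫ y, φ y ∂(μ + ENNReal.ofReal ε • Measure.dirac x))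
      (φ x) (Set.Ici 0) 0 := by
  set a := ∫ y, φ y ∂μ
  have e1 : HasDerivAt (fun ε : ℝ => a + ε * φ x) (φ x) 0 := by
    simpa using ((hasDerivAt_id (0:ℝ)).mul_const (φ x)).const_add a
  refine e1.hasDerivWithinAt.congr (fun ε hε => ?_) ?_
  · rw [integral_pert h hε]
  · simp [a]

lemma hasDeriv_exp
    {μ : Measure (EuclideanSpace ℝ (Fin d))} (h : MW w μ) (x : EuclideanSpace ℝ (Fin d)) :
    HasDerivWithinAt (fun ε : ℝ =>
      Real.exp (-(∫ y, w y ∂(μ + ENNReal.ofReal ε • Measure.dirac x))))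
      (-(w x) * Real.exp (-(∫ y, w y ∂μ))) (Set.Ici 0) 0 := by
  refine (hasDeriv_phi h.2 x).neg.exp.congr_deriv ?_
  simp
  ring

lemma hasDeriv_gen {φ : EuclideanSpace ℝ (Fin d) → ℝ} (hφ : Continuous φ)
    (hc : HasCompactSupport φ)
    {μ : Measure (EuclideanSpace ℝ (Fin d))} (h : MW w μ) (x : EuclideanSpace ℝ (Fin d)) :
    HasDerivWithinAt (fun ε : ℝ => gen w φ (μ + ENNReal.ofReal ε • Measure.dirac x))
      ((φ x - (∫ y, φ y ∂μ) * w x) * Real.exp (-(∫ y, w y ∂μ))) (Set.Ici 0) 0 := by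
  obtain ⟨h1, h2⟩ := h
  have hi : Integrable φ μ := hφ.integrable_of_hasCompactSupport hc
  refine ((hasDeriv_phi hi x).mul (hasDeriv_exp ⟨h1, h2⟩ x)).congr_deriv ?_
  simp
  ring

lemma hasDeriv_genpow {φ : EuclideanSpace ℝ (Fin d) → ℝ} (hφ : Continuous φ)
    (hc : HasCompactSupport φ) (m : ℕ)
    {μ : Measure (EuclideanSpace ℝ (Fin d))} (h : MW w μ) (x : EuclideanSpace ℝ (Fin d)) :
    HasDerivWithinAt (fun ε : ℝ => gen w φ (μ + ENNReal.ofReal ε • Measure.dirac x) ^ m)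
      (m * gen w φ μ ^ (m - 1) *
        ((φ x - (∫ y, φ y ∂μ) * w x) * Real.exp (-(∫ y, w y ∂μ)))) (Set.Ici 0) 0 := by
  refine ((hasDeriv_gen hφ hc h x).pow m).congr_deriv ?_
  simp

lemma mderiv_genpow {φ : EuclideanSpace ℝ (Fin d) → ℝ} (hφ : Continuous φ)
    (hc : HasCompactSupport φ) (m : ℕ)
    {μ : Measure (EuclideanSpace ℝ (Fin d))} (h : MW w μ) (x : EuclideanSpace ℝ (Fin d)) :
    mderiv (fun μ => gen w φ μ ^ (m + 1)) μ x = (m + 1) * gen w φ μ ^ m *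
        ((φ x - (∫ y, φ y ∂μ) * w x) * Real.exp (-(∫ y, w y ∂μ))) := by
  rw [mderiv, (hasDeriv_genpow hφ hc (m+1) h x).derivWithin (uniqueDiffWithinAt_Ici 0)]
  simp

lemma hasDeriv2_genpow {φ : EuclideanSpace ℝ (Fin d) → ℝ} (hφ : Continuous φ)
    (hc : HasCompactSupport φ) (m : ℕ)
    {μ : Measure (EuclideanSpace ℝ (Fin d))} (h : MW w μ) (x y : EuclideanSpace ℝ (Fin d)) :
    HasDerivWithinAt (fun ε : ℝ => mderiv (fun μ => gen w φ μ ^ (m + 1))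
        (μ + ENNReal.ofReal ε • Measure.dirac x) y)
      ((m + 1) * m * gen w φ μ ^ (m - 1) * Real.exp (-(∫ y, w y ∂μ)) ^ 2 *
        ((φ x - (∫ y, φ y ∂μ) * w x) * (φ y - (∫ y, φ y ∂μ) * w y))
       + (m + 1) * gen w φ μ ^ m * Real.exp (-(∫ y, w y ∂μ)) *
        ((∫ y, φ y ∂μ) * (w x * w y) - (w x * φ y + φ x * w y))) (Set.Ici 0) 0 := by
  have h1 := h.1
  have hi : Integrable φ μ := hφ.integrable_of_hasCompactSupport hc
  have D := ((hasDeriv_genpow hφ hc m h x).const_mul ((m:ℝ) + 1)).mul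
    ((((hasDeriv_phi hi x).mul_const (w y)).const_sub (φ y)).mul (hasDeriv_exp h x))
  refine (D.congr_of_eventuallyEq (f₁ := fun ε : ℝ => mderiv (fun μ => gen w φ μ ^ (m + 1))
        (μ + ENNReal.ofReal ε • Measure.dirac x) y) (.of_forall fun ε => ?_) ?_).congr_deriv ?_
  · simp only [Pi.mul_apply]
    exact mderiv_genpow hφ hc m (h.add_dirac ε x) y
  · simp only [Pi.mul_apply]
    exact mderiv_genpow hφ hc m (h.add_dirac 0 x) y
  · simp
    ring

lemma mderiv2_genpow {φ : EuclideanSpace ℝ (Fin d) → ℝ} (hφ : Continuous φ)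
    (hc : HasCompactSupport φ) (m : ℕ)
    {μ : Measure (EuclideanSpace ℝ (Fin d))} (h : MW w μ) (x y : EuclideanSpace ℝ (Fin d)) :
    mderiv2 (fun μ => gen w φ μ ^ (m + 1)) μ x y =
      ((m + 1) * m * gen w φ μ ^ (m - 1) * Real.exp (-(∫ y, w y ∂μ)) ^ 2 *
        ((φ x - (∫ y, φ y ∂μ) * w x) * (φ y - (∫ y, φ y ∂μ) * w y))
       + (m + 1) * gen w φ μ ^ m * Real.exp (-(∫ y, w y ∂μ)) *
        ((∫ y, φ y ∂μ) * (w x * w y) - (w x * φ y + φ x * w y))) := by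
  rw [mderiv2, mderiv,
    (hasDeriv2_genpow hφ hc m h x y).derivWithin (uniqueDiffWithinAt_Ici 0)]

lemma CwInf.cont (hw : Continuous w) {φ : EuclideanSpace ℝ (Fin d) → ℝ} (hφ : φ ∈ CwInf w) :
    Continuous φ := by
  obtain ⟨c, ψ, h3, h4, rfl⟩ := hφ
  have := h3.continuous
  fun_prop

lemma w_mem : w ∈ CwInf w :=
  ⟨1, fun _ => 0, contDiff_const, HasCompactSupport.zero, by simp⟩

lemma CwInf.lin {φ ψ : EuclideanSpace ℝ (Fin d) → ℝ} (a b : ℝ) (hφ : φ ∈ CwInf w)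
    (hψ : ψ ∈ CwInf w) : (fun x => a * φ x + b * ψ x) ∈ CwInf w := by
  obtain ⟨c, φ', h3, h4, rfl⟩ := hφ
  obtain ⟨c', ψ', h3', h4', rfl⟩ := hψ
  refine ⟨a * c + b * c', fun x => a * φ' x + b * ψ' x, ?_, ?_, ?_⟩
  · exact (contDiff_const.mul h3).add (contDiff_const.mul h3')
  · exact (h4.mul_left (f := fun _ => a)).add (h4'.mul_left (f := fun _ => b))
  · funext x; ring

lemma CwTensor.lin {φ ψ : EuclideanSpace ℝ (Fin d) × EuclideanSpace ℝ (Fin d) → ℝ} (a b : ℝ)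
    (hφ : φ ∈ CwTensor w) (hψ : ψ ∈ CwTensor w) :
    (fun x => a * φ x + b * ψ x) ∈ CwTensor w :=
  Submodule.add_mem _ (Submodule.smul_mem _ a hφ) (Submodule.smul_mem _ b hψ)

lemma CwTensor.sq {φ : EuclideanSpace ℝ (Fin d) → ℝ} (hφ : φ ∈ CwInf w) :
    (fun q : EuclideanSpace ℝ (Fin d) × EuclideanSpace ℝ (Fin d) => φ q.1 * φ q.2) ∈ CwTensor w :=
  Submodule.subset_span ⟨φ, hφ, φ, hφ, rfl⟩

lemma ae_pw {M : Measure (Measure (EuclideanSpace ℝ (Fin d)))} (hM : M (PwS w E)ᶜ = 0) :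
    ∀ᵐ ν ∂M, ν ∈ PwS w E := by
  rw [ae_iff]; exact hM

lemma aem_int (hw : Continuous w) {M : Measure (Measure (EuclideanSpace ℝ (Fin d)))}
    (hM : M (PwS w E)ᶜ = 0) {φ : EuclideanSpace ℝ (Fin d) → ℝ} (hφ : φ ∈ CwInf w) :
    AEMeasurable (fun ν => ∫ x, φ x ∂ν) M := by
  have hm := (CwInf.cont hw hφ).measurable
  refine ⟨fun ν => (∫⁻ x, ENNReal.ofReal (φ x) ∂ν).toReal
    - (∫⁻ x, ENNReal.ofReal (-φ x) ∂ν).toReal, ?_, ?_⟩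
  · exact (Measure.measurable_lintegral hm.ennreal_ofReal).ennreal_toReal.sub
      (Measure.measurable_lintegral hm.neg.ennreal_ofReal).ennreal_toReal
  · filter_upwards [ae_pw hM] with ν hν
    exact integral_eq_lintegral_pos_part_sub_lintegral_neg_part ((PwS.mw hν).integrable hφ)

lemma exp_lip {t R : ℝ} (hR : 1 ≤ R) (ht : Real.exp (-t) ≤ R) :
    |Real.exp (-t) - 1| ≤ R * |t| := by
  have h1 := Real.add_one_le_exp (-t)
  have h2 := Real.add_one_le_exp t
  have h3 : Real.exp t * Real.exp (-t) = 1 := by rw [← Real.exp_add]; simp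
  have h4 := Real.exp_pos (-t)
  rcases le_total 0 t with h | h
  · rw [abs_of_nonneg h, abs_le]
    constructor <;> nlinarith
  · rw [abs_of_nonpos h, abs_le]
    constructor <;> nlinarith

lemma est_bd {K R a a0 t : ℝ} (ha : |a| ≤ K) (ha0 : |a0| ≤ K) (ht : Real.exp (-t) ≤ R) :
    |a * Real.exp (-t) - a0| ≤ K * (R + 1) := by
  have h1 : |a * Real.exp (-t)| ≤ K * R := by
    rw [abs_mul, abs_of_pos (Real.exp_pos _)]
    exact mul_le_mul ha ht (Real.exp_pos _).le ((abs_nonneg _).trans ha)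
  calc _ ≤ |a * Real.exp (-t)| + |a0| := abs_sub _ _
    _ ≤ K * (R + 1) := by linarith

lemma min_case {X C C1 u v : ℝ} (hC : 0 ≤ C) (hC1 : 0 ≤ C1) (hu : 0 ≤ u) (hv : 0 ≤ v)
    (h1 : X ≤ C1) (h2 : u ≤ 1 → v ≤ 1 → X ≤ C * (u + v)) :
    X ≤ (C + C1) * (min 1 u + min 1 v) := by
  rcases le_total u 1 with hu1 | hu1 <;> rcases le_total v 1 with hv1 | hv1
  · rw [min_eq_right hu1, min_eq_right hv1]
    have := h2 hu1 hv1
    nlinarith [mul_nonneg hC1 (add_nonneg hu hv)]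
  · rw [min_eq_right hu1, min_eq_left hv1]; nlinarith [mul_nonneg hC hu, mul_nonneg hC1 hu]
  · rw [min_eq_left hu1, min_eq_right hv1]; nlinarith [mul_nonneg hC hv, mul_nonneg hC1 hv]
  · rw [min_eq_left hu1, min_eq_left hv1]; nlinarith

lemma est_sq {K R a a0 t : ℝ} (ha : |a| ≤ K) (ha0 : |a0| ≤ K) (hR : 1 ≤ R)
    (ht : Real.exp (-t) ≤ R) :
    |a * Real.exp (-t) - a0| ^ 2 ≤ ((2 * R ^ 2 + 2 * (K * R) ^ 2) + (K * (R + 1)) ^ 2) *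
      (min 1 ((a0 - a) ^ 2) + min 1 (t ^ 2)) := by
  have hK : 0 ≤ K := (abs_nonneg _).trans ha
  refine min_case (by positivity) (by positivity) (by positivity) (by positivity) ?_ ?_
  · exact pow_le_pow_left₀ (abs_nonneg _) (est_bd ha ha0 ht) 2
  · intro _ _
    have h1 : |a * Real.exp (-t) - a0| ≤ R * |a0 - a| + K * R * |t| := by
      have e : a * Real.exp (-t) - a0 = -((a0 - a) * Real.exp (-t)) + a0 * (Real.exp (-t) - 1) := by
        ring
      rw [e]
      refine (abs_add_le _ _).trans ?_
      rw [abs_neg, abs_mul, abs_mul, abs_of_pos (Real.exp_pos _)]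
      have := mul_le_mul ha0 (exp_lip hR ht) (abs_nonneg _) hK
      have := mul_le_mul_of_nonneg_left ht (abs_nonneg (a0 - a))
      linarith
    calc _ ≤ (R * |a0 - a| + K * R * |t|) ^ 2 := pow_le_pow_left₀ (abs_nonneg _) h1 2
      _ ≤ 2 * (R * |a0 - a|) ^ 2 + 2 * (K * R * |t|) ^ 2 := by
        nlinarith [sq_nonneg (R * |a0 - a| - K * R * |t|)]
      _ = 2 * R ^ 2 * (a0 - a) ^ 2 + 2 * (K * R) ^ 2 * t ^ 2 := by
        rw [mul_pow, mul_pow _ |t|, sq_abs, sq_abs]; ring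
      _ ≤ _ := by
        nlinarith [mul_nonneg (sq_nonneg R) (sq_nonneg t),
          mul_nonneg (sq_nonneg (K * R)) (sq_nonneg (a0 - a))]

lemma est_d {K R a a0 t : ℝ} {ρ : ℝ → ℝ} (ha : |a| ≤ K) (ha0 : |a0| ≤ K) (hR : 1 ≤ R)
    (ht : Real.exp (-t) ≤ R) (hρ_range : ∀ r, ρ r ∈ Set.Icc (0:ℝ) 1)
    (hρ_supp : ∀ r : ℝ, r ∉ Set.Icc (-2:ℝ) 2 → ρ r = 0)
    (hρ_one : ∀ r ∈ Set.Icc (-1:ℝ) 1, ρ r = 1) :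
    |a * Real.exp (-t) - a0 - ρ t * ((a - a0) - a0 * t)| ≤ ((R + K) + K * (R + 5)) *
      (min 1 ((a0 - a) ^ 2) + min 1 (t ^ 2)) := by
  have hK : 0 ≤ K := (abs_nonneg _).trans ha
  refine min_case (by positivity) (by positivity) (by positivity) (by positivity) ?_ ?_
  · have h1 := est_bd ha ha0 ht
    have h2 : |ρ t * ((a - a0) - a0 * t)| ≤ 4 * K := by
      by_cases h : t ∈ Set.Icc (-2:ℝ) 2
      · rw [abs_mul, abs_of_nonneg (hρ_range t).1]
        have h3 : |t| ≤ 2 := abs_le.mpr h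
        have h4 : |(a - a0) - a0 * t| ≤ 4 * K := by
          calc _ ≤ |a - a0| + |a0 * t| := abs_sub _ _
            _ ≤ (|a| + |a0|) + |a0| * |t| := by
              rw [abs_mul]; gcongr; exact abs_sub _ _
            _ ≤ 4 * K := by nlinarith [mul_le_mul ha0 h3 (abs_nonneg _) hK]
        calc _ ≤ 1 * (4 * K) := mul_le_mul (hρ_range t).2 h4 (abs_nonneg _) zero_le_one
          _ = _ := one_mul _
      · rw [hρ_supp t h]; simp; positivity
    calc _ ≤ |a * Real.exp (-t) - a0| + |ρ t * ((a - a0) - a0 * t)| := abs_sub _ _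
      _ ≤ _ := by linarith
  · intro _ h
    have h3 : |t| ≤ 1 := by rwa [sq_le_one_iff_abs_le_one] at h
    rw [hρ_one t (abs_le.mp h3)]
    have e : a * Real.exp (-t) - a0 - 1 * ((a - a0) - a0 * t)
      = -((a0 - a) * (Real.exp (-t) - 1)) + a0 * (Real.exp (-t) - 1 - (-t)) := by ring
    rw [e]
    refine (abs_add_le _ _).trans ?_
    rw [abs_neg, abs_mul, abs_mul]
    have h4 := Real.abs_exp_sub_one_sub_id_le (x := -t) (by rwa [abs_neg])
    rw [neg_sq] at h4
    have h5 := mul_le_mul ha0 h4 (abs_nonneg _) hK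
    have h6 := mul_le_mul_of_nonneg_left (exp_lip hR ht) (abs_nonneg (a0 - a))
    have h7 : |a0 - a| * |t| ≤ (a0 - a) ^ 2 + t ^ 2 := by
      rw [← sq_abs (a0 - a), ← sq_abs t]
      nlinarith [sq_nonneg (|a0 - a| - |t|), sq_nonneg (|a0 - a|), sq_nonneg (|t|)]
    nlinarith [mul_le_mul_of_nonneg_left h7 (zero_le_one.trans hR),
      mul_nonneg hK (sq_nonneg (a0 - a))]

section jump
variable {M : Measure (Measure (EuclideanSpace ℝ (Fin d)))}
  {μ : Measure (EuclideanSpace ℝ (Fin d))} {φ : EuclideanSpace ℝ (Fin d) → ℝ} {ρ : ℝ → ℝ}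

lemma int_min (hw : Continuous w) (hM : M (PwS w E)ᶜ = 0)
    (hN : ∀ φ ∈ CwInf w,
      (∫⁻ ν, ENNReal.ofReal (min 1 (((∫ x, φ x ∂μ) - (∫ x, φ x ∂ν)) ^ 2)) ∂M) < ⊤)
    (hφ : φ ∈ CwInf w) :
    Integrable (fun ν => min 1 (((∫ x, φ x ∂μ) - (∫ x, φ x ∂ν)) ^ 2)) M := by
  have hm : AEMeasurable (fun ν => min 1 (((∫ x, φ x ∂μ) - (∫ x, φ x ∂ν)) ^ 2)) M :=
    aemeasurable_const.min (((aem_int hw hM hφ).const_sub _).pow_const 2)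
  refine ⟨hm.aestronglyMeasurable, ?_⟩
  rw [hasFiniteIntegral_iff_ofReal (.of_forall fun ν => le_min zero_le_one (sq_nonneg _))]
  exact hN φ hφ

lemma abs_int_le {K : ℝ} (hK : ∀ x, |φ x| ≤ K) {ν : Measure (EuclideanSpace ℝ (Fin d))}
    (hν : ν ∈ PwS w E) : |∫ x, φ x ∂ν| ≤ K := by
  have := hν.1
  simpa using norm_integral_le_of_norm_le_const (μ := ν) (f := φ) (.of_forall hK)

lemma exp_le (hw1 : ∀ x, 1 ≤ w x) {ν : Measure (EuclideanSpace ℝ (Fin d))} :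
    Real.exp (-((∫ x, w x ∂ν) - ∫ x, w x ∂μ)) ≤ Real.exp (∫ x, w x ∂μ) := by
  have : 0 ≤ ∫ x, w x ∂ν := integral_nonneg fun x => zero_le_one.trans (hw1 x)
  exact Real.exp_le_exp.mpr (by linarith)

lemma one_le_R (hw1 : ∀ x, 1 ≤ w x) : 1 ≤ Real.exp (∫ x, w x ∂μ) :=
  Real.one_le_exp (integral_nonneg fun x => zero_le_one.trans (hw1 x))

lemma int_d (hw : Continuous w) (hw1 : ∀ x, 1 ≤ w x) (hμ : μ ∈ PwS w E) (hM : M (PwS w E)ᶜ = 0)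
    (hN : ∀ φ ∈ CwInf w,
      (∫⁻ ν, ENNReal.ofReal (min 1 (((∫ x, φ x ∂μ) - (∫ x, φ x ∂ν)) ^ 2)) ∂M) < ⊤)
    (hφ : φ ∈ CwInf w) (hc : HasCompactSupport φ) (hρ : Continuous ρ)
    (hρ_range : ∀ r, ρ r ∈ Set.Icc (0:ℝ) 1)
    (hρ_supp : ∀ r : ℝ, r ∉ Set.Icc (-2:ℝ) 2 → ρ r = 0)
    (hρ_one : ∀ r ∈ Set.Icc (-1:ℝ) 1, ρ r = 1) :
    Integrable (fun ν => (∫ x, φ x ∂ν) * Real.exp (-((∫ x, w x ∂ν) - (∫ x, w x ∂μ)))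
          - (∫ x, φ x ∂μ)
          - ρ ((∫ x, w x ∂ν) - (∫ x, w x ∂μ)) *
            (((∫ x, φ x ∂ν) - (∫ x, φ x ∂μ))
              - (∫ x, φ x ∂μ) * ((∫ x, w x ∂ν) - (∫ x, w x ∂μ)))) M := by
  obtain ⟨K, hK⟩ := hc.exists_bound_of_continuous (CwInf.cont hw hφ)
  have m1 := aem_int hw hM hφ
  have m2 := (aem_int hw hM (w_mem (w := w))).sub_const (∫ x, w x ∂μ)
  refine Integrable.mono' (((int_min hw hM hN hφ).add (int_min hw hM hN w_mem)).const_mul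
    ((Real.exp (∫ x, w x ∂μ) + K) + K * (Real.exp (∫ x, w x ∂μ) + 5))) ?_ ?_
  · refine AEMeasurable.aestronglyMeasurable ?_
    exact ((m1.mul (Real.measurable_exp.comp_aemeasurable m2.neg)).sub_const _).sub
      ((hρ.measurable.comp_aemeasurable m2).mul ((m1.sub_const _).sub (m2.const_mul _)))
  · filter_upwards [ae_pw hM] with ν hν
    have := est_d (ρ := ρ) (abs_int_le hK hν) (abs_int_le hK hμ) (one_le_R hw1)
      (exp_le (μ := μ) (ν := ν) hw1) hρ_range hρ_supp hρ_one
    rw [sub_sq_comm (∫ x, w x ∂ν) (∫ x, w x ∂μ)] at this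
    simpa using this

lemma int_e (hw : Continuous w) (hw1 : ∀ x, 1 ≤ w x) (hμ : μ ∈ PwS w E) (hM : M (PwS w E)ᶜ = 0)
    (hN : ∀ φ ∈ CwInf w,
      (∫⁻ ν, ENNReal.ofReal (min 1 (((∫ x, φ x ∂μ) - (∫ x, φ x ∂ν)) ^ 2)) ∂M) < ⊤)
    (hφ : φ ∈ CwInf w) (hc : HasCompactSupport φ) (k : ℕ) :
    Integrable (fun ν => ((∫ x, φ x ∂ν) * Real.exp (-((∫ x, w x ∂ν) - (∫ x, w x ∂μ)))
          - (∫ x, φ x ∂μ)) ^ (k + 2)) M := by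
  obtain ⟨K, hK⟩ := hc.exists_bound_of_continuous (CwInf.cont hw hφ)
  have hK0 : 0 ≤ K := (norm_nonneg _).trans (hK 0)
  have m1 := aem_int hw hM hφ
  have m2 := (aem_int hw hM (w_mem (w := w))).sub_const (∫ x, w x ∂μ)
  set R := Real.exp (∫ x, w x ∂μ) with hR
  have hR1 : 1 ≤ R := one_le_R hw1
  refine Integrable.mono' (((int_min hw hM hN hφ).add (int_min hw hM hN w_mem)).const_mul
    ((K * (R + 1)) ^ k * ((2 * R ^ 2 + 2 * (K * R) ^ 2) + (K * (R + 1)) ^ 2))) ?_ ?_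
  · refine AEMeasurable.aestronglyMeasurable ?_
    exact ((m1.mul (Real.measurable_exp.comp_aemeasurable m2.neg)).sub_const _).pow_const _
  · filter_upwards [ae_pw hM] with ν hν
    have h1 := est_sq (abs_int_le hK hν) (abs_int_le hK hμ) hR1
      (exp_le (μ := μ) (ν := ν) hw1)
    have h2 := est_bd (abs_int_le hK hν) (abs_int_le hK hμ)
      (exp_le (μ := μ) (ν := ν) hw1)
    rw [sub_sq_comm (∫ x, w x ∂ν) (∫ x, w x ∂μ)] at h1
    rw [Real.norm_eq_abs, abs_pow, pow_add, mul_assoc]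
    exact mul_le_mul (pow_le_pow_left₀ (abs_nonneg _) h2 k) h1 (by positivity) (by positivity)

end jump

/-- Jump integrand. -/
def jmp (w : EuclideanSpace ℝ (Fin d) → ℝ) (ρ : ℝ → ℝ)
    (f : Measure (EuclideanSpace ℝ (Fin d)) → ℝ)
    (μ ν : Measure (EuclideanSpace ℝ (Fin d))) : ℝ :=
  f ν - f μ - ρ ((∫ x, w x ∂ν) - (∫ x, w x ∂μ)) *
    ((∫ x, mderiv f μ x ∂ν) - (∫ x, mderiv f μ x ∂μ))

/-- Regularity used to show linearity. -/
structure Good (w : EuclideanSpace ℝ (Fin d) → ℝ) (E : Set (EuclideanSpace ℝ (Fin d)))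
    (N : Measure (EuclideanSpace ℝ (Fin d)) → Measure (Measure (EuclideanSpace ℝ (Fin d))))
    (ρ : ℝ → ℝ) (f : Measure (EuclideanSpace ℝ (Fin d)) → ℝ) : Prop where
  d1 : ∀ μ, MW w μ → ∀ y, DifferentiableWithinAt ℝ
    (fun ε : ℝ => f (μ + ENNReal.ofReal ε • Measure.dirac y)) (Set.Ici 0) 0
  d2 : ∀ μ, MW w μ → ∀ x y, DifferentiableWithinAt ℝ
    (fun ε : ℝ => mderiv f (μ + ENNReal.ofReal ε • Measure.dirac x) y) (Set.Ici 0) 0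
  m1 : ∀ μ ∈ PwS w E, (fun y => mderiv f μ y) ∈ CwInf w
  m2 : ∀ μ ∈ PwS w E, (fun q : EuclideanSpace ℝ (Fin d) × EuclideanSpace ℝ (Fin d) =>
    mderiv2 f μ q.1 q.2) ∈ CwTensor w
  j : ∀ μ ∈ PwS w E, Integrable (jmp w ρ f μ) (N μ)

section lin
variable {N : Measure (EuclideanSpace ℝ (Fin d)) → Measure (Measure (EuclideanSpace ℝ (Fin d)))}
  {ρ : ℝ → ℝ} {f g : Measure (EuclideanSpace ℝ (Fin d)) → ℝ}

lemma mderiv_lin (hf : Good w E N ρ f) (hg : Good w E N ρ g) (a b : ℝ)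
    {μ : Measure (EuclideanSpace ℝ (Fin d))} (h : MW w μ) (y : EuclideanSpace ℝ (Fin d)) :
    mderiv (fun μ => a * f μ + b * g μ) μ y = a * mderiv f μ y + b * mderiv g μ y :=
  (((hf.d1 μ h y).hasDerivWithinAt.const_mul a).add
    ((hg.d1 μ h y).hasDerivWithinAt.const_mul b)).derivWithin (uniqueDiffWithinAt_Ici 0)

lemma mderiv_pert_lin (hf : Good w E N ρ f) (hg : Good w E N ρ g) (a b : ℝ)
    {μ : Measure (EuclideanSpace ℝ (Fin d))} (h : MW w μ) (x y : EuclideanSpace ℝ (Fin d)) :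
    HasDerivWithinAt (fun ε : ℝ => mderiv (fun μ => a * f μ + b * g μ)
      (μ + ENNReal.ofReal ε • Measure.dirac x) y)
      (a * mderiv2 f μ x y + b * mderiv2 g μ x y) (Set.Ici 0) 0 := by
  have e : (fun ε : ℝ => mderiv (fun μ => a * f μ + b * g μ)
      (μ + ENNReal.ofReal ε • Measure.dirac x) y) = fun ε : ℝ =>
      a * mderiv f (μ + ENNReal.ofReal ε • Measure.dirac x) y
      + b * mderiv g (μ + ENNReal.ofReal ε • Measure.dirac x) y := by
    funext ε
    exact mderiv_lin hf hg a b (h.add_dirac ε x) y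
  rw [e]
  exact (((hf.d2 μ h x y).hasDerivWithinAt.const_mul a).add
    ((hg.d2 μ h x y).hasDerivWithinAt.const_mul b))

lemma mderiv2_lin (hf : Good w E N ρ f) (hg : Good w E N ρ g) (a b : ℝ)
    {μ : Measure (EuclideanSpace ℝ (Fin d))} (h : MW w μ) (x y : EuclideanSpace ℝ (Fin d)) :
    mderiv2 (fun μ => a * f μ + b * g μ) μ x y = a * mderiv2 f μ x y + b * mderiv2 g μ x y :=
  (mderiv_pert_lin hf hg a b h x y).derivWithin (uniqueDiffWithinAt_Ici 0)

lemma int_mderiv_lin (hf : Good w E N ρ f) (hg : Good w E N ρ g) (a b : ℝ)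
    {μ ν : Measure (EuclideanSpace ℝ (Fin d))} (h : μ ∈ PwS w E) (h' : ν ∈ PwS w E) :
    ∫ x, mderiv (fun μ => a * f μ + b * g μ) μ x ∂ν
      = a * (∫ x, mderiv f μ x ∂ν) + b * (∫ x, mderiv g μ x ∂ν) := by
  simp only [mderiv_lin hf hg a b (PwS.mw h)]
  rw [integral_add (((PwS.mw h').integrable (hf.m1 μ h)).const_mul a)
    (((PwS.mw h').integrable (hg.m1 μ h)).const_mul b), integral_const_mul, integral_const_mul]

lemma jmp_lin (hf : Good w E N ρ f) (hg : Good w E N ρ g) (a b : ℝ)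
    {μ ν : Measure (EuclideanSpace ℝ (Fin d))} (h : μ ∈ PwS w E) (h' : ν ∈ PwS w E) :
    jmp w ρ (fun μ => a * f μ + b * g μ) μ ν = a * jmp w ρ f μ ν + b * jmp w ρ g μ ν := by
  simp only [jmp]
  rw [int_mderiv_lin hf hg a b h h', int_mderiv_lin hf hg a b h h]
  ring

lemma good_lin (hN : ∀ μ ∈ PwS w E, N μ (PwS w E)ᶜ = 0)
    (hf : Good w E N ρ f) (hg : Good w E N ρ g) (a b : ℝ) :
    Good w E N ρ (fun μ => a * f μ + b * g μ) where
  d1 μ h y := ((hf.d1 μ h y).const_mul a).add ((hg.d1 μ h y).const_mul b)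
  d2 μ h x y := (mderiv_pert_lin hf hg a b h x y).differentiableWithinAt
  m1 μ h := by
    simp only [mderiv_lin hf hg a b (PwS.mw h)]
    exact CwInf.lin a b (hf.m1 μ h) (hg.m1 μ h)
  m2 μ h := by
    simp only [mderiv2_lin hf hg a b (PwS.mw h)]
    exact CwTensor.lin a b (hf.m2 μ h) (hg.m2 μ h)
  j μ h := by
    refine (((hf.j μ h).const_mul a).add ((hg.j μ h).const_mul b)).congr ?_
    filter_upwards [ae_pw (hN μ h)] with ν hν
    simp [jmp_lin hf hg a b h hν]

end lin

section congr
variable {N : Measure (EuclideanSpace ℝ (Fin d)) → Measure (Measure (EuclideanSpace ℝ (Fin d)))}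
  {ρ : ℝ → ℝ} {f g : Measure (EuclideanSpace ℝ (Fin d)) → ℝ}

lemma mderiv_congr (hfg : ∀ μ, MW w μ → f μ = g μ)
    {μ : Measure (EuclideanSpace ℝ (Fin d))} (h : MW w μ) (y : EuclideanSpace ℝ (Fin d)) :
    mderiv f μ y = mderiv g μ y := by
  simp only [mderiv]
  congr 1
  funext ε
  exact hfg _ (h.add_dirac ε y)

lemma mderiv2_congr (hfg : ∀ μ, MW w μ → f μ = g μ)
    {μ : Measure (EuclideanSpace ℝ (Fin d))} (h : MW w μ) (x y : EuclideanSpace ℝ (Fin d)) :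
    mderiv2 f μ x y = mderiv2 g μ x y :=
  mderiv_congr (fun _ hν => mderiv_congr hfg hν y) h x

lemma jmp_congr (hfg : ∀ μ, MW w μ → f μ = g μ)
    {μ ν : Measure (EuclideanSpace ℝ (Fin d))} (h : μ ∈ PwS w E) (h' : ν ∈ PwS w E) :
    jmp w ρ f μ ν = jmp w ρ g μ ν := by
  simp only [jmp, mderiv_congr hfg (PwS.mw h), hfg μ (PwS.mw h), hfg ν (PwS.mw h')]

lemma Good.congr (hN : ∀ μ ∈ PwS w E, N μ (PwS w E)ᶜ = 0)
    (hfg : ∀ μ, MW w μ → f μ = g μ) (hg : Good w E N ρ g) : Good w E N ρ f where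
  d1 μ h y := by
    simp only [fun ε : ℝ => hfg _ (h.add_dirac ε y)]
    exact hg.d1 μ h y
  d2 μ h x y := by
    simp only [fun ε : ℝ => mderiv_congr hfg (h.add_dirac ε x) y]
    exact hg.d2 μ h x y
  m1 μ h := by
    simp only [mderiv_congr hfg (PwS.mw h)]
    exact hg.m1 μ h
  m2 μ h := by
    simp only [mderiv2_congr hfg (PwS.mw h)]
    exact hg.m2 μ h
  j μ h := by
    rw [integrable_congr ((ae_pw (hN μ h)).mono fun ν hν => jmp_congr hfg h hν)]
    exact hg.j μ h

end congr

/-- Restriction to finite measures integrating w. -/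
def resMW (w : EuclideanSpace ℝ (Fin d) → ℝ) (f : Measure (EuclideanSpace ℝ (Fin d)) → ℝ) :
    {μ : Measure (EuclideanSpace ℝ (Fin d)) // MW w μ} → ℝ := fun μ => f μ.1

lemma res_adjoin {S : Set (Measure (EuclideanSpace ℝ (Fin d)) → ℝ)}
    {f : Measure (EuclideanSpace ℝ (Fin d)) → ℝ} (hf : f ∈ NonUnitalAlgebra.adjoin ℝ S) :
    resMW w f ∈ NonUnitalAlgebra.adjoin ℝ (resMW w '' S) := by
  induction hf using NonUnitalAlgebra.adjoin_induction with
  | mem x hx => exact NonUnitalAlgebra.subset_adjoin ℝ ⟨x, hx, rfl⟩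
  | add x y _ _ hx hy => exact add_mem hx hy
  | zero => exact zero_mem _
  | smul r x _ hx => exact SMulMemClass.smul_mem r hx
  | mul x y _ _ hx hy => exact mul_mem hx hy

lemma res_closed (t : ℝ) : ∀ g ∈ resMW w '' DwGen w, ∀ h ∈ resMW w '' DwGen w,
    h + t • g ∈ resMW w '' DwGen w := by
  rintro _ ⟨_, ⟨φ, h1, h2, rfl⟩, rfl⟩ _ ⟨_, ⟨ψ, h3, h4, rfl⟩, rfl⟩
  refine ⟨_, ⟨fun x => ψ x + t * φ x, h3.add (contDiff_const.mul h1),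
    h4.add (h2.mul_left (f := fun _ => t)), rfl⟩, ?_⟩
  funext μ
  have := μ.2.1
  simp only [resMW, Pi.add_apply, Pi.smul_apply, smul_eq_mul]
  rw [integral_add (h3.continuous.integrable_of_hasCompactSupport h4)
    ((h1.continuous.integrable_of_hasCompactSupport h2).const_mul t), integral_const_mul]
  ring

section gen
variable {N : Measure (EuclideanSpace ℝ (Fin d)) → Measure (Measure (EuclideanSpace ℝ (Fin d)))}
  {ρ : ℝ → ℝ} {φ : EuclideanSpace ℝ (Fin d) → ℝ} {μ : Measure (EuclideanSpace ℝ (Fin d))}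

lemma phi_mem (hφ : ContDiff ℝ (⊤ : ℕ∞) φ) (hc : HasCompactSupport φ) : φ ∈ CwInf w :=
  ⟨0, φ, hφ, hc, by simp⟩

/-- First derivative as a combination. -/
lemma mderiv_gen_eq (hφ : Continuous φ) (hc : HasCompactSupport φ) (m : ℕ) (h : MW w μ) :
    (fun y => mderiv (fun μ => gen w φ μ ^ (m + 1)) μ y) = fun y =>
      ((m + 1) * gen w φ μ ^ m * Real.exp (-(∫ y, w y ∂μ))) * φ y
      + (-((m + 1) * gen w φ μ ^ m * Real.exp (-(∫ y, w y ∂μ)) * (∫ y, φ y ∂μ))) * w y := by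
  funext y
  rw [mderiv_genpow hφ hc m h]
  ring

/-- Second derivative as a combination. -/
lemma mderiv2_gen_eq (hφ : Continuous φ) (hc : HasCompactSupport φ) (m : ℕ) (h : MW w μ)
    (A α β : ℝ) (hA : A = ∫ y, φ y ∂μ)
    (hα : α = (m + 1) * m * gen w φ μ ^ (m - 1) * Real.exp (-(∫ y, w y ∂μ)) ^ 2)
    (hβ : β = (m + 1) * gen w φ μ ^ m * Real.exp (-(∫ y, w y ∂μ))) :
    (fun q : EuclideanSpace ℝ (Fin d) × EuclideanSpace ℝ (Fin d) =>
        mderiv2 (fun μ => gen w φ μ ^ (m + 1)) μ q.1 q.2) = fun q =>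
      1 * ((fun q : EuclideanSpace ℝ (Fin d) × EuclideanSpace ℝ (Fin d) =>
        (α + α * A + β) * (fun q : EuclideanSpace ℝ (Fin d) × EuclideanSpace ℝ (Fin d) =>
          φ q.1 * φ q.2) q
        + (α * A + α * A ^ 2 + β * A + β) *
          (fun q : EuclideanSpace ℝ (Fin d) × EuclideanSpace ℝ (Fin d) => w q.1 * w q.2) q) q)
      + (-(α * A) - β) * (fun q : EuclideanSpace ℝ (Fin d) × EuclideanSpace ℝ (Fin d) =>
        (fun x => 1 * w x + 1 * φ x) q.1 * (fun x => 1 * w x + 1 * φ x) q.2) q := by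
  funext q
  rw [mderiv2_genpow hφ hc m h, ← hA, ← hα, ← hβ]
  ring

lemma jmp_gen (hφ : Continuous φ) (hc : HasCompactSupport φ) (m : ℕ) (h : μ ∈ PwS w E)
    {ν : Measure (EuclideanSpace ℝ (Fin d))} (h' : ν ∈ PwS w E) :
    jmp w ρ (fun μ => gen w φ μ ^ (m + 1)) μ ν =
      ((m + 1) * gen w φ μ ^ m * Real.exp (-(∫ y, w y ∂μ))) *
        ((∫ x, φ x ∂ν) * Real.exp (-((∫ x, w x ∂ν) - (∫ x, w x ∂μ)))
          - (∫ x, φ x ∂μ)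
          - ρ ((∫ x, w x ∂ν) - (∫ x, w x ∂μ)) *
            (((∫ x, φ x ∂ν) - (∫ x, φ x ∂μ))
              - (∫ x, φ x ∂μ) * ((∫ x, w x ∂ν) - (∫ x, w x ∂μ))))
      + ∑ i ∈ Finset.range m, (((m + 1).choose (i + 2) : ℝ) * gen w φ μ ^ (m + 1 - (i + 2)) *
          Real.exp (-((i + 2 : ℕ) : ℝ) * (∫ x, w x ∂μ))) *
          ((∫ x, φ x ∂ν) * Real.exp (-((∫ x, w x ∂ν) - (∫ x, w x ∂μ)))
          - (∫ x, φ x ∂μ)) ^ (i + 2) := by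
  have hi : ∀ ν ∈ PwS w E, Integrable φ ν := fun ν hν => by
    have := hν.1
    exact hφ.integrable_of_hasCompactSupport hc
  have hI : ∀ ν ∈ PwS w E, ∫ x, mderiv (fun μ => gen w φ μ ^ (m + 1)) μ x ∂ν
      = ((m + 1) * gen w φ μ ^ m * Real.exp (-(∫ y, w y ∂μ))) * (∫ x, φ x ∂ν)
      + (-((m + 1) * gen w φ μ ^ m * Real.exp (-(∫ y, w y ∂μ)) * (∫ y, φ y ∂μ))) *
        (∫ x, w x ∂ν) := fun ν hν => by
    have e := mderiv_gen_eq hφ hc m (PwS.mw h)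
    rw [e, integral_add ((hi ν hν).const_mul _) (hν.2.1.const_mul _), integral_const_mul,
      integral_const_mul]
  simp only [jmp]
  rw [hI ν h', hI μ h]
  set G := (∫ x, φ x ∂ν) * Real.exp (-((∫ x, w x ∂ν) - (∫ x, w x ∂μ))) - (∫ x, φ x ∂μ) with hG
  have e1 : gen w φ ν = Real.exp (-(∫ x, w x ∂μ)) * G + gen w φ μ := by
    have : Real.exp (-(∫ x, w x ∂ν)) =
        Real.exp (-(∫ x, w x ∂μ)) * Real.exp (-((∫ x, w x ∂ν) - (∫ x, w x ∂μ))) := by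
      rw [← Real.exp_add]; congr 1; ring
    rw [hG, gen, gen, this]; ring
  have e2 : ∀ i : ℕ, Real.exp (-((i + 2 : ℕ) : ℝ) * (∫ x, w x ∂μ))
      = Real.exp (-(∫ x, w x ∂μ)) ^ (i + 2) := fun i => by
    rw [← Real.exp_nat_mul]; congr 1; ring
  have e3 : gen w φ ν ^ (m + 1) = (∑ i ∈ Finset.range m,
      (((m + 1).choose (i + 2) : ℝ) * gen w φ μ ^ (m + 1 - (i + 2)) *
          Real.exp (-((i + 2 : ℕ) : ℝ) * (∫ x, w x ∂μ))) * G ^ (i + 2))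
      + (m + 1) * gen w φ μ ^ m * (Real.exp (-(∫ x, w x ∂μ)) * G) + gen w φ μ ^ (m + 1) := by
    rw [e1, add_pow, Finset.sum_range_succ', Finset.sum_range_succ']
    congr 1
    · congr 1
      · refine Finset.sum_congr rfl fun i _ => ?_
        rw [e2, mul_pow]; ring
      · simp; ring
    · simp
  rw [e3]
  ring

lemma good_gen (hw : Continuous w) (hw1 : ∀ x, 1 ≤ w x)
    (hM : ∀ μ ∈ PwS w E, N μ (PwS w E)ᶜ = 0)
    (hN : ∀ μ ∈ PwS w E, ∀ φ ∈ CwInf w,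
      (∫⁻ ν, ENNReal.ofReal (min 1 (((∫ x, φ x ∂μ) - (∫ x, φ x ∂ν)) ^ 2)) ∂(N μ)) < ⊤)
    (hφ : ContDiff ℝ (⊤ : ℕ∞) φ) (hc : HasCompactSupport φ) (hρ : Continuous ρ)
    (hρ_range : ∀ r, ρ r ∈ Set.Icc (0:ℝ) 1)
    (hρ_supp : ∀ r : ℝ, r ∉ Set.Icc (-2:ℝ) 2 → ρ r = 0)
    (hρ_one : ∀ r ∈ Set.Icc (-1:ℝ) 1, ρ r = 1) (m : ℕ) :
    Good w E N ρ (fun μ => gen w φ μ ^ (m + 1)) where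
  d1 μ h y := (hasDeriv_genpow hφ.continuous hc (m + 1) h y).differentiableWithinAt
  d2 μ h x y := (hasDeriv2_genpow hφ.continuous hc m h x y).differentiableWithinAt
  m1 μ h := by
    rw [mderiv_gen_eq hφ.continuous hc m (PwS.mw h)]
    exact CwInf.lin _ _ (phi_mem hφ hc) w_mem
  m2 μ h := by
    rw [mderiv2_gen_eq hφ.continuous hc m (PwS.mw h) _ _ _ rfl rfl rfl]
    exact CwTensor.lin _ _ (CwTensor.lin _ _ (CwTensor.sq (phi_mem hφ hc)) (CwTensor.sq w_mem))
      (CwTensor.sq (CwInf.lin 1 1 w_mem (phi_mem hφ hc)))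
  j μ h := by
    have i1 := int_d hw hw1 h (hM μ h) (hN μ h) (phi_mem hφ hc) hc hρ hρ_range hρ_supp hρ_one
    have i2 := int_e hw hw1 h (hM μ h) (hN μ h) (phi_mem hφ hc) hc
    have e := (ae_pw (hM μ h)).mono fun ν hν => jmp_gen (ρ := ρ) hφ.continuous hc m h hν
    rw [integrable_congr e]
    exact (i1.const_mul _).add (integrable_finsetSum (Finset.range m)
      fun i _ => (i2 i).const_mul _)

end gen

end helpers

/-- Let `L` be of Lévy type and satisfy the positive maximum principle on
`𝒫_w` with `Lf ∈ C(𝒫_w)` for `f ∈ 𝒟_w`.  If the functions (a)–(e) built from the killing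
rate `κ`, drift `B`, diffusion `Q` and jump kernel `N` are all of `C₀` type, then `Lf` is
of `C₀` type for every `f ∈ 𝒟_w`. -/
theorem stmt_18 {d : ℕ} (w : EuclideanSpace ℝ (Fin d) → ℝ)
    (hw_smooth : ContDiff ℝ (⊤ : ℕ∞) w) (hw_one : ∀ x, 1 ≤ w x)
    (hw_infty : Tendsto w (cocompact (EuclideanSpace ℝ (Fin d))) atTop)
    (E : Set (EuclideanSpace ℝ (Fin d))) (hE_closed : IsClosed E) (hE_noncompact : ¬ IsCompact E)
    (Pw : Set (Measure (EuclideanSpace ℝ (Fin d))))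
    (hPw : Pw = {μ | IsProbabilityMeasure μ ∧ Integrable w μ ∧ μ Eᶜ = 0})
    -- the Lévy-type characteristics:
    (κ : Measure (EuclideanSpace ℝ (Fin d)) → ℝ)
    (B : Measure (EuclideanSpace ℝ (Fin d)) → (EuclideanSpace ℝ (Fin d) → ℝ) →
      EuclideanSpace ℝ (Fin d) → ℝ)
    (Q : Measure (EuclideanSpace ℝ (Fin d)) →
      (EuclideanSpace ℝ (Fin d) × EuclideanSpace ℝ (Fin d) → ℝ) →
      EuclideanSpace ℝ (Fin d) × EuclideanSpace ℝ (Fin d) → ℝ)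
    (N : Measure (EuclideanSpace ℝ (Fin d)) → Measure (Measure (EuclideanSpace ℝ (Fin d))))
    (ρ : ℝ → ℝ)
    -- `κ_μ ∈ ℝ_+`:
    (hκ : ∀ μ ∈ Pw, 0 ≤ κ μ)
    -- `B_μ` is a linear operator from `C_w^∞` to `L¹(E,μ)`:
    (hB_int : ∀ μ ∈ Pw, ∀ φ ∈ CwInf w, Integrable (B μ φ) μ)
    (hB_lin : ∀ μ ∈ Pw, ∀ a b : ℝ, ∀ φ ∈ CwInf w, ∀ ψ ∈ CwInf w,
      B μ (fun x => a * φ x + b * ψ x) =ᵐ[μ] fun x => a * B μ φ x + b * B μ ψ x)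
    -- `Q_μ` is a linear operator from `C_w^∞ ⊗ C_w^∞` to `L¹(E×E, μ⊗μ)`, positive on squares:
    (hQ_int : ∀ μ ∈ Pw, ∀ ψ ∈ CwTensor w, Integrable (Q μ ψ) (μ.prod μ))
    (hQ_lin : ∀ μ ∈ Pw, ∀ a b : ℝ, ∀ ψ₁ ∈ CwTensor w, ∀ ψ₂ ∈ CwTensor w,
      Q μ (fun p => a * ψ₁ p + b * ψ₂ p) =ᵐ[μ.prod μ] fun p => a * Q μ ψ₁ p + b * Q μ ψ₂ p)
    (hQ_pos : ∀ μ ∈ Pw, ∀ φ ∈ CwInf w,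
      0 ≤ ∫ p, Q μ (fun q => φ q.1 * φ q.2) p ∂(μ.prod μ))
    -- `N(μ,dν)` is a measure on `𝒫_w` with `∫ 1 ∧ ⟨φ,μ−ν⟩² N(μ,dν) < ∞`:
    (hN_supp : ∀ μ ∈ Pw, N μ Pwᶜ = 0)
    (hN_int : ∀ μ ∈ Pw, ∀ φ ∈ CwInf w,
      (∫⁻ ν, ENNReal.ofReal (min 1 (((∫ x, φ x ∂μ) - (∫ x, φ x ∂ν)) ^ 2)) ∂(N μ)) < ⊤)
    -- the truncation profile `ρ`:
    (hρ_smooth : ContDiff ℝ (⊤ : ℕ∞) ρ) (hρ_range : ∀ r, ρ r ∈ Set.Icc (0:ℝ) 1)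
    (hρ_supp : ∀ r : ℝ, r ∉ Set.Icc (-2:ℝ) 2 → ρ r = 0)
    (hρ_one : ∀ r ∈ Set.Icc (-1:ℝ) 1, ρ r = 1)
    -- `L` is of Lévy type (5.1):
    (L : (Measure (EuclideanSpace ℝ (Fin d)) → ℝ) → Measure (EuclideanSpace ℝ (Fin d)) → ℝ)
    (hL : ∀ f : Measure (EuclideanSpace ℝ (Fin d)) → ℝ, ∀ μ,
      L f μ = -(κ μ) * f μ
        + (∫ x, B μ (fun y => mderiv f μ y) x ∂μ)
        + (1/2) * (∫ p, Q μ (fun q => mderiv2 f μ q.1 q.2) p ∂(μ.prod μ))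
        + (∫ ν, (f ν - f μ
            - ρ ((∫ x, w x ∂ν) - (∫ x, w x ∂μ)) *
              ((∫ x, mderiv f μ x ∂ν) - (∫ x, mderiv f μ x ∂μ))) ∂(N μ)))
    -- condition (i): the positive maximum principle on `𝒫_w`:
    (hPMP : ∀ f ∈ NonUnitalAlgebra.adjoin ℝ (DwGen w), ∀ μ ∈ Pw,
      (∀ ν ∈ Pw, f ν ≤ f μ) → 0 ≤ f μ → L f μ ≤ 0)
    -- condition (ii): `Lf ∈ C(𝒫_w)` (sequential continuity in the topology of `𝒫_w`):
    (hCont : ∀ f ∈ NonUnitalAlgebra.adjoin ℝ (DwGen w), ∀ μ ∈ Pw,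
      ∀ μs : ℕ → Measure (EuclideanSpace ℝ (Fin d)), (∀ n, μs n ∈ Pw) →
      (∀ g : BoundedContinuousFunction (EuclideanSpace ℝ (Fin d)) ℝ,
        Tendsto (fun n => ∫ x, g x ∂(μs n)) atTop (𝓝 (∫ x, g x ∂μ))) →
      Tendsto (fun n => ∫ x, w x ∂(μs n)) atTop (𝓝 (∫ x, w x ∂μ)) →
      Tendsto (fun n => L f (μs n)) atTop (𝓝 (L f μ)))
    -- condition (a):
    (ha : IsC0Type w E (fun μ => κ μ * Real.exp (-(∫ x, w x ∂μ))))
    -- condition (b):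
    (hb : ∀ φ ∈ CwInf w,
      IsC0Type w E (fun μ => (∫ x, B μ φ x ∂μ) * Real.exp (-(∫ x, w x ∂μ))))
    -- condition (c):
    (hc : ∀ φ ∈ CwInf w,
      IsC0Type w E (fun μ =>
        (∫ p, Q μ (fun q => φ q.1 * φ q.2) p ∂(μ.prod μ)) * Real.exp (-(∫ x, w x ∂μ))))
    -- condition (d):
    (hd : ∀ φ ∈ CwInf w,
      IsC0Type w E (fun μ => Real.exp (-(∫ x, w x ∂μ)) *
        ∫ ν, ((∫ x, φ x ∂ν) * Real.exp (-((∫ x, w x ∂ν) - (∫ x, w x ∂μ)))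
          - (∫ x, φ x ∂μ)
          - ρ ((∫ x, w x ∂ν) - (∫ x, w x ∂μ)) *
            (((∫ x, φ x ∂ν) - (∫ x, φ x ∂μ))
              - (∫ x, φ x ∂μ) * ((∫ x, w x ∂ν) - (∫ x, w x ∂μ)))) ∂(N μ)))
    -- condition (e):
    (he : ∀ φ ∈ CwInf w, ∀ k : ℕ, 2 ≤ k →
      IsC0Type w E (fun μ => Real.exp (-(k : ℝ) * (∫ x, w x ∂μ)) *
        ∫ ν, ((∫ x, φ x ∂ν) * Real.exp (-((∫ x, w x ∂ν) - (∫ x, w x ∂μ)))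
          - (∫ x, φ x ∂μ)) ^ k ∂(N μ))) :
    ∀ f ∈ NonUnitalAlgebra.adjoin ℝ (DwGen w), IsC0Type w E (L f) := by
  obtain rfl : Pw = PwS w E := hPw
  have hwc := hw_smooth.continuous
  have Bint : ∀ μ ∈ PwS w E, ∀ a b : ℝ, ∀ φ ∈ CwInf w, ∀ ψ ∈ CwInf w,
      ∫ x, B μ (fun x => a * φ x + b * ψ x) x ∂μ
        = a * (∫ x, B μ φ x ∂μ) + b * (∫ x, B μ ψ x ∂μ) := by
    intro μ hμ a b φ hφ ψ hψ
    rw [integral_congr_ae (hB_lin μ hμ a b φ hφ ψ hψ),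
      integral_add ((hB_int μ hμ φ hφ).const_mul a) ((hB_int μ hμ ψ hψ).const_mul b),
      integral_const_mul, integral_const_mul]
  have Qint : ∀ μ ∈ PwS w E, ∀ a b : ℝ, ∀ φ ∈ CwTensor w, ∀ ψ ∈ CwTensor w,
      ∫ x, Q μ (fun x => a * φ x + b * ψ x) x ∂(μ.prod μ)
        = a * (∫ x, Q μ φ x ∂(μ.prod μ)) + b * (∫ x, Q μ ψ x ∂(μ.prod μ)) := by
    intro μ hμ a b φ hφ ψ hψ
    rw [integral_congr_ae (hQ_lin μ hμ a b φ hφ ψ hψ),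
      integral_add ((hQ_int μ hμ φ hφ).const_mul a) ((hQ_int μ hμ ψ hψ).const_mul b),
      integral_const_mul, integral_const_mul]
  have hL' : ∀ f : Measure (EuclideanSpace ℝ (Fin d)) → ℝ, ∀ μ,
      L f μ = -(κ μ) * f μ
        + (∫ x, B μ (fun y => mderiv f μ y) x ∂μ)
        + (1/2) * (∫ p, Q μ (fun q => mderiv2 f μ q.1 q.2) p ∂(μ.prod μ))
        + (∫ ν, jmp w ρ f μ ν ∂(N μ)) := hL
  have hlin : ∀ (a b : ℝ) (f g : Measure (EuclideanSpace ℝ (Fin d)) → ℝ),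
      Good w E N ρ f ∧ IsC0Type w E (L f) → Good w E N ρ g ∧ IsC0Type w E (L g) →
      Good w E N ρ (fun μ => a * f μ + b * g μ) ∧
        IsC0Type w E (L (fun μ => a * f μ + b * g μ)) := by
    rintro a b f g ⟨hf, hf0⟩ ⟨hg, hg0⟩
    refine ⟨good_lin hN_supp hf hg a b, c0_congr
      (c0_add (c0_const_mul a hf0) (c0_const_mul b hg0)) fun μ hμ => ?_⟩
    rw [hL' _ μ, hL' f μ, hL' g μ]
    simp only [mderiv_lin hf hg a b (PwS.mw hμ), mderiv2_lin hf hg a b (PwS.mw hμ)]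
    rw [Bint μ hμ a b _ (hf.m1 μ hμ) _ (hg.m1 μ hμ),
      Qint μ hμ a b _ (hf.m2 μ hμ) _ (hg.m2 μ hμ)]
    have e := (ae_pw (hN_supp μ hμ)).mono fun ν hν => jmp_lin hf hg a b hμ hν
    rw [integral_congr_ae e,
      integral_add ((hf.j μ hμ).const_mul a) ((hg.j μ hμ).const_mul b),
      integral_const_mul, integral_const_mul]
    ring
  have hgen : ∀ φ : EuclideanSpace ℝ (Fin d) → ℝ, ContDiff ℝ (⊤ : ℕ∞) φ → HasCompactSupport φ →
      ∀ m : ℕ, Good w E N ρ (fun μ => gen w φ μ ^ (m + 1)) ∧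
        IsC0Type w E (L (fun μ => gen w φ μ ^ (m + 1))) := by
    intro φ hφ hc' m
    refine ⟨good_gen hwc hw_one hN_supp hN_int hφ hc' hρ_smooth.continuous hρ_range hρ_supp
      hρ_one m, ?_⟩
    have hφm : φ ∈ CwInf w := phi_mem hφ hc'
    have hsm : (fun x => 1 * w x + 1 * φ x) ∈ CwInf w := CwInf.lin 1 1 w_mem hφm
    have cA := cb_phi hE_closed hwc hw_one hφ.continuous hc'
    have cX := cb_exp (w := w) (E := E) hE_closed hw_one
    have cG : IsCbType w E (fun μ => gen w φ μ) := cb_mul cA cX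
    have cGp := fun n => cb_pow cG n
    -- the pieces
    have p1 := c0_mul (cb_mul (cb_mul (cb_const (-1)) cA) (cGp m)) ha
    have p2 := c0_mul (cb_mul (cb_const ((m:ℝ)+1)) (cGp m)) (hb φ hφm)
    have p3 := c0_mul (cb_mul (cb_const (-((m:ℝ)+1))) (cb_mul cA (cGp m))) (hb w w_mem)
    have cα := cb_mul (cb_const (1/2 * (((m:ℝ)+1) * m))) (cb_mul (cGp (m-1)) cX)
    have cβ := cb_mul (cb_const (1/2 * ((m:ℝ)+1))) (cGp m)
    have q1 := hc φ hφm
    have q2 := hc w w_mem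
    have q3 := hc _ hsm
    have r1 := c0_add (c0_add (c0_mul cα q1) (c0_mul cα (c0_mul cA q1))) (c0_mul cβ q1)
    have r2 := c0_add (c0_add (c0_mul cα (c0_mul cA q2)) (c0_mul cα (c0_mul (cb_pow cA 2) q2)))
      (c0_add (c0_mul cβ (c0_mul cA q2)) (c0_mul cβ q2))
    have r3 := c0_const_mul (-1) (c0_add (c0_mul cα (c0_mul cA q3)) (c0_mul cβ q3))
    have s1 := c0_mul (cb_mul (cb_const ((m:ℝ)+1)) (cGp m)) (hd φ hφm)
    have s2 := c0_sum (Finset.range m) fun i _ =>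
      c0_mul (cb_mul (cb_const ((m+1).choose (i+2) : ℝ)) (cGp (m + 1 - (i+2))))
        (he φ hφm (i+2) (by omega))
    refine c0_congr (c0_add (c0_add (c0_add p1 (c0_add p2 p3)) (c0_add r1 (c0_add r2 r3)))
      (c0_add s1 s2)) fun μ hμ => ?_
    rw [hL' _ μ, mderiv_gen_eq hφ.continuous hc' m (PwS.mw hμ),
      Bint μ hμ _ _ φ hφm w w_mem,
      mderiv2_gen_eq hφ.continuous hc' m (PwS.mw hμ) _ _ _ rfl rfl rfl,
      Qint μ hμ _ _ _ (CwTensor.lin _ _ (CwTensor.sq hφm) (CwTensor.sq w_mem)) _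
        (CwTensor.sq hsm),
      Qint μ hμ _ _ _ (CwTensor.sq hφm) _ (CwTensor.sq w_mem)]
    have i1 := int_d hwc hw_one hμ (hN_supp μ hμ) (hN_int μ hμ) hφm hc' hρ_smooth.continuous
      hρ_range hρ_supp hρ_one
    have i2 := int_e hwc hw_one hμ (hN_supp μ hμ) (hN_int μ hμ) hφm hc'
    have e := (ae_pw (hN_supp μ hμ)).mono fun ν hν =>
      jmp_gen (ρ := ρ) hφ.continuous hc' m hμ hν
    rw [integral_congr_ae e, integral_add (i1.const_mul _)
      (integrable_finsetSum (Finset.range m) fun i _ => (i2 i).const_mul _),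
      integral_finsetSum _ (fun i _ => (i2 i).const_mul _), integral_const_mul]
    simp only [integral_const_mul]
    refine congrArg₂ (· + ·) ?_ (congrArg₂ (· + ·) ?_ ?_)
    · rw [pow_succ (gen w φ μ) m]
      have eg : gen w φ μ = (∫ x, φ x ∂μ) * Real.exp (-(∫ x, w x ∂μ)) := rfl
      generalize gen w φ μ ^ (m - 1) = Y
      generalize gen w φ μ ^ m = Z
      rw [eg]
      ring
    · ring
    · refine Finset.sum_congr rfl fun i _ => ?_
      ring
  have hcongr : ∀ f g : Measure (EuclideanSpace ℝ (Fin d)) → ℝ, (∀ μ, MW w μ → f μ = g μ) →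
      Good w E N ρ g ∧ IsC0Type w E (L g) → Good w E N ρ f ∧ IsC0Type w E (L f) := by
    rintro f g hfg ⟨h1, h2⟩
    refine ⟨h1.congr hN_supp hfg, c0_congr h2 fun μ hμ => ?_⟩
    rw [hL' f μ, hL' g μ, hfg μ (PwS.mw hμ)]
    simp only [mderiv_congr hfg (PwS.mw hμ), mderiv2_congr hfg (PwS.mw hμ)]
    rw [integral_congr_ae ((ae_pw (hN_supp μ hμ)).mono fun ν hν => jmp_congr hfg hμ hν)]
  intro f hf
  have hspan := adjoin_le_span _ res_closed _ (res_adjoin (w := w) hf)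
  have key : ∀ p ∈ Submodule.span ℝ {p | ∃ g ∈ resMW w '' DwGen w, ∃ m : ℕ, p = g ^ (m + 1)},
      ∃ f, resMW w f = p ∧ Good w E N ρ f ∧ IsC0Type w E (L f) := by
    intro p hp
    induction hp using Submodule.span_induction with
    | mem x hx =>
      obtain ⟨_, ⟨_, ⟨φ, h1, h2, rfl⟩, rfl⟩, m, rfl⟩ := hx
      exact ⟨_, rfl, hgen φ h1 h2 m⟩
    | zero =>
      have h0 := hgen 0 contDiff_const HasCompactSupport.zero 0
      refine ⟨_, ?_, hlin 0 0 _ _ h0 h0⟩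
      funext μ
      simp [resMW]
    | add x y _ _ hx hy =>
      obtain ⟨f, rfl, hf⟩ := hx
      obtain ⟨g, rfl, hg⟩ := hy
      refine ⟨_, ?_, hlin 1 1 _ _ hf hg⟩
      funext μ
      simp [resMW]
    | smul a x _ hx =>
      obtain ⟨f, rfl, hf⟩ := hx
      refine ⟨_, ?_, hlin a 0 _ _ hf hf⟩
      funext μ
      simp [resMW]
  obtain ⟨g, hg, hg'⟩ := key _ hspan
  exact (hcongr f g (fun μ hμ => (congrFun hg ⟨μ, hμ⟩).symm) hg').2
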